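/- The length of the Mochizuki 3-cocycle ζ of the 7-dihedral quandle R₇ is equal to 8. Precisely: (1) for every R₇-set S, l(ζ,S) ≤ 8, i.e., if some 3-cycle γ of (R₇,S) satisfies ζ(π(γ)) ≠ 0 then some such γ has length l(γ) ≤ 8; and (2) l(ζ, ℤ×R₇) = 8, i.e., there exists a 3-cycle γ of (R₇, ℤ×R₇) with ζ(π(γ)) ≠ 0 and l(γ) = 8, and every 3-cycle γ of (R₇, ℤ×R₇) with ζ(π(γ)) ≠ 0 has l(γ) ≥ 8. -/

import Mathlib

namespace QHom

variable {X S : Type*}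

/-- Generating tuples: an element of `S` together with a list of quandle elements
whose consecutive entries are distinct. -/
abbrev Gen (X S : Type*) := {p : S × List X // p.2.Chain' (· ≠ ·)}

/-- The chain group: the free abelian group on `Gen X S`. -/
abbrev Ch (X S : Type*) := Gen X S →₀ ℤ

/-- The basis chain associated to a tuple; `0` if two consecutive entries coincide. -/
noncomputable def gen (s : S) (l : List X) : Ch X S := by
  classical
  exact if h : l.Chain' (· ≠ ·) then Finsupp.single ⟨(s, l), h⟩ 1 else 0

noncomputable def fOn (t : Gen X S) : Ch X S :=
  ∑ j : Fin t.1.2.length, ((-1 : ℤ) ^ ((j : ℕ) + 1)) • gen t.1.1 (t.1.2.eraseIdx (j : ℕ))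

/-- The map `f`. -/
noncomputable def fmap (γ : Ch X S) : Ch X S := γ.sum fun t c => c • fOn t

noncomputable def gOn (op : X → X → X) (sact : S → X → S) (t : Gen X S) : Ch X S :=
  ∑ j : Fin t.1.2.length,
    ((-1 : ℤ) ^ (j : ℕ)) •
      gen (sact t.1.1 (t.1.2.get j))
        ((t.1.2.take (j : ℕ)).map (fun x => op x (t.1.2.get j)) ++ t.1.2.drop ((j : ℕ) + 1))

/-- The map `g`. -/
noncomputable def gmap (op : X → X → X) (sact : S → X → S) (γ : Ch X S) : Ch X S :=
  γ.sum fun t c => c • gOn op sact t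

/-- The boundary map `∂ = f + g`. -/
noncomputable def bd (op : X → X → X) (sact : S → X → S) (γ : Ch X S) : Ch X S :=
  fmap γ + gmap op sact γ

/-- `γ` is an `m`-chain: it is supported on tuples of length `m`. -/
def IsMChain (m : ℕ) (γ : Ch X S) : Prop := ∀ t ∈ γ.support, t.1.2.length = m

/-- The length of a chain: the sum of the absolute values of its coefficients. -/
noncomputable def chainLen (γ : Ch X S) : ℕ := γ.sum fun _ c => c.natAbs

/-- `π` : forget the `S`-coordinate. -/
noncomputable def proj (γ : Ch X S) : Ch X Unit := γ.sum fun t c => c • gen () t.1.2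

/-- Evaluation of a cochain (given by its values on generating tuples) on a chain. -/
noncomputable def evalCh {A : Type*} [AddCommGroup A] (θ : List X → A) (δ : Ch X Unit) : A :=
  δ.sum fun t c => c • θ t.1.2

/-- The action of quandle generators on the `X`-set `ℤ × X`. -/
def zact (op : X → X → X) (s : ℤ × X) (a : X) : ℤ × X := (s.1 + 1, op s.2 a)

/-- `γ` is a 3-term of degree `n` and index `u`. -/
def IsTerm3 (γ : Ch X (ℤ × X)) (n : ℤ) (u : X) : Prop :=
  ∃ ε a b c, (ε = (1 : ℤ) ∨ ε = -1) ∧ a ≠ b ∧ b ≠ c ∧ γ = ε • gen (n, u) [a, b, c]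

def Efficient {k : ℕ} (γ : Fin k → Ch X S) : Prop := ∀ i j, i ≠ j → γ i ≠ -γ j

def FConnected {k : ℕ} (γ : Fin k → Ch X S) : Prop :=
  Efficient γ ∧ (∑ i, fmap (γ i)) = 0 ∧
    ∀ I : Finset (Fin k), I.Nonempty → I ≠ Finset.univ → (∑ i ∈ I, fmap (γ i)) ≠ 0

def GConnected {k : ℕ} (op : X → X → X) (sact : S → X → S) (γ : Fin k → Ch X S) : Prop :=
  Efficient γ ∧ (∑ i, gmap op sact (γ i)) = 0 ∧
    ∀ I : Finset (Fin k), I.Nonempty → I ≠ Finset.univ → (∑ i ∈ I, gmap op sact (γ i)) ≠ 0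

/-- `n` is the minimal degree of `γ`. -/
def MinDegree (γ : Ch X (ℤ × X)) (n : ℤ) : Prop :=
  (∃ t ∈ γ.support, t.1.1.1 = n) ∧ ∀ t ∈ γ.support, n ≤ t.1.1.1

/-- `|T_k(γ)|`: the number of terms (with multiplicity) of `γ` of degree `k`. -/
noncomputable def Tcount (γ : Ch X (ℤ × X)) (k : ℤ) : ℕ :=
  γ.sum fun t c => if t.1.1.1 = k then c.natAbs else 0

def revList (op : X → X → X) : List X → List X
  | [] => []
  | a :: l => l.foldl op a :: revList op l

/-- The reverse of a chain of `(X, ℤ × X)` (a chain of the dual quandle). -/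
noncomputable def reverse (op : X → X → X) (γ : Ch X (ℤ × X)) : Ch X (ℤ × X) :=
  γ.sum fun t c => c • gen (-t.1.1.1, t.1.2.foldl op t.1.1.2) (revList op t.1.2)

/-- The degree-shift automorphism `σ`. -/
noncomputable def sigmaMap (γ : Ch X (ℤ × X)) : Ch X (ℤ × X) :=
  γ.sum fun t c => c • gen (t.1.1.1 + 1, t.1.1.2) t.1.2

/-- `γ` is a 3-term of type `ty` with respect to the operation `op`. -/
def IsTypedTerm (op : X → X → X) (γ : Ch X (ℤ × X)) (ty : ℕ) : Prop :=
  ∃ (ε n : ℤ) (u a b c : X), (ε = 1 ∨ ε = -1) ∧ a ≠ b ∧ b ≠ c ∧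
    γ = ε • gen (n, u) [a, b, c] ∧
    ((ty = 0 ∧ a = c ∧ op a b = c) ∨ (ty = 1 ∧ a = c ∧ op a b ≠ c) ∨
      (ty = 2 ∧ a ≠ c ∧ op a b = c) ∨ (ty = 3 ∧ a ≠ c ∧ op a b ≠ c))

/-- A bigon 3-term `⟨x, y⟩` of degree `n` and index `u`. -/
def IsBigon (n : ℤ) (u x y : X) (δ : Ch X (ℤ × X)) : Prop :=
  δ = gen (n, u) [x, y, x] ∨ δ = gen (n, u) [y, x, y]

/-- The case shapes (A), (B), (C). -/
def Shape (δ : Ch X (ℤ × X)) (n : ℤ) (l : ℕ) : Prop :=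
  (4 ≤ l ∧ l ≤ 7 ∧ Tcount δ n = l) ∨
  (6 ≤ l ∧ l ≤ 7 ∧ Tcount δ n = 2 ∧ Tcount δ (n + 1) = l - 2) ∨
  (6 ≤ l ∧ l ≤ 7 ∧ Tcount δ n = 3 ∧ Tcount δ (n + 1) = l - 3)

/-- A quandle structure on `X`. -/
structure QuandleStr (X : Type*) where
  op : X → X → X
  idem : ∀ a, op a a = a
  bij : ∀ b, Function.Bijective fun a => op a b
  dist : ∀ a b c, op (op a b) c = op (op a c) (op b c)

/-- The dual quandle operation. -/
noncomputable def dualOp (Q : QuandleStr X) : X → X → X :=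
  fun a b => (Equiv.ofBijective (fun x => Q.op x b) (Q.bij b)).symm a

/-- An `X`-set: a set with a right action of the associated group `G(X)`, recorded via its
action of the generators, which is bijective generator-wise and compatible with the
defining relations of `G(X)`. -/
structure QSet (X : Type*) (op : X → X → X) (S : Type*) where
  sact : S → X → S
  bij : ∀ a, Function.Bijective fun s => sact s a
  comm : ∀ s a b, sact (sact s a) b = sact (sact s b) (op a b)

/-- The 7-dihedral quandle operation on `ZMod 7`. -/
def R7op : ZMod 7 → ZMod 7 → ZMod 7 := fun a b => 2 * b - a

def zetaInt (a b c : ℤ) : ℤ := (a - b) * ((b ^ 7 + (2 * c - b) ^ 7 - 2 * c ^ 7) / 7)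

/-- The Mochizuki 3-cocycle on triples. -/
def zetaFun (a b c : ZMod 7) : ZMod 7 := (zetaInt a.val b.val c.val : ℤ)

def zetaL : List (ZMod 7) → ZMod 7
  | [a, b, c] => zetaFun a b c
  | _ => 0

/-- The octahedral quandle operation on `Fin 6`: `octAct a b = σ_b(a)`. -/
def octAct : Fin 6 → Fin 6 → Fin 6 := fun a b =>
  ![![0, 2, 4, 3, 5, 1],
    ![5, 1, 0, 2, 4, 3],
    ![1, 3, 2, 4, 0, 5],
    ![0, 5, 1, 3, 2, 4],
    ![2, 1, 3, 5, 4, 0],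
    ![4, 0, 2, 1, 3, 5]] b a

/-- `σ₀`, the rotation about the axis through `0` and `3`. -/
def sig0 : Fin 6 → Fin 6 := fun a => octAct a 0

def etaTriples1 : List (Fin 6 × Fin 6 × Fin 6) :=
  [(0, 1, 2), (0, 3, 1), (1, 2, 0), (1, 4, 2), (3, 1, 5)]

def etaTriples2 : List (Fin 6 × Fin 6 × Fin 6) :=
  [(0, 1, 5), (1, 0, 1), (1, 0, 5), (1, 2, 1), (1, 3, 1), (1, 3, 2), (1, 4, 5), (1, 5, 1),
    (3, 0, 1), (3, 1, 0), (3, 1, 2)]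

/-- The 3-cocycle `η` of the octahedral quandle, on triples. -/
noncomputable def etaFun (a b c : Fin 6) : ZMod 3 := by
  classical
  exact
    if ∃ k : ℕ, ∃ p ∈ etaTriples1, a = sig0^[k] p.1 ∧ b = sig0^[k] p.2.1 ∧ c = sig0^[k] p.2.2
      then 1
    else if ∃ k : ℕ, ∃ p ∈ etaTriples2, a = sig0^[k] p.1 ∧ b = sig0^[k] p.2.1 ∧ c = sig0^[k] p.2.2
      then 2
    else 0

noncomputable def etaL : List (Fin 6) → ZMod 3
  | [a, b, c] => etaFun a b c
  | _ => 0

/-! ### A kernel-evaluable search for short cycles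

Faces are encoded as `((7 d + u) 7 + x) 7 + y`; a partial boundary is a pair of lists of such keys,
those with coefficient `+1` and those with coefficient `-1`.  The functions are written with
recursors and in continuation-passing style so that the kernel evaluates them efficiently. -/

section Search

/-- A term `((d, u); a, b, c)` with natural number entries. -/
structure NTerm where
  d : ℕ
  u : ℕ
  a : ℕ
  b : ℕ
  c : ℕ

def faceKey (d u x y : ℕ) : ℕ :=
  Nat.add (Nat.mul (Nat.add (Nat.mul (Nat.add (Nat.mul d (nat_lit 7)) u) (nat_lit 7)) x)
    (nat_lit 7)) y

/-- `2 x - y` modulo `7`. -/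
def refl7 (x y : ℕ) : ℕ :=
  Nat.mod (Nat.add (Nat.mul (nat_lit 2) x) (Nat.sub (nat_lit 7) y)) (nat_lit 7)

/-- Application `f n`, evaluating `n` to a literal first. -/
noncomputable def force (n : ℕ) (f : ℕ → Bool) : Bool :=
  Nat.rec (f (nat_lit 0)) (fun m _ => f (Nat.succ m)) n

noncomputable def ite' {α : Type} (b : Bool) (t e : α) : α := Bool.rec e t b

noncomputable def memK (k : ℕ) (l : List ℕ) : Bool :=
  List.rec false (fun x _ ih => Bool.rec ih true (Nat.beq x k)) l

noncomputable def eraseK (k : ℕ) (l : List ℕ) : List ℕ :=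
  List.rec [] (fun x t ih => Bool.rec (x :: ih) t (Nat.beq x k)) l

noncomputable def lenK (l : List ℕ) : ℕ := List.rec (nat_lit 0) (fun _ _ ih => Nat.succ ih) l

noncomputable def minK (l : List ℕ) (n : ℕ) : ℕ :=
  List.rec n (fun x _ ih => ite' (Nat.ble x ih) x ih) l

/-- Add the face `k` with sign `s` to the boundary `pos - neg`, where at most `sl` faces may be
added without a cancellation; degenerate faces (`x = y`) are ignored. -/
noncomputable def addFace (s : Bool) (x y k sl : ℕ) (pos neg : List ℕ)
    (cont : ℕ → List ℕ → List ℕ → Bool) : Bool :=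
  ite' (Nat.beq x y) (cont sl pos neg) <|
  force k fun k =>
  ite' s
    (ite' (memK k neg) (cont sl pos (eraseK k neg))
      (Nat.rec true (fun sl _ => cont sl (k :: pos) neg) sl))
    (ite' (memK k pos) (cont sl (eraseK k pos) neg)
      (Nat.rec true (fun sl _ => cont sl pos (k :: neg)) sl))

/-- Add the boundary of a term with sign `s`. -/
noncomputable def addTerm (s : Bool) (d u a b c sl : ℕ) (pos neg : List ℕ)
    (cont : ℕ → List ℕ → List ℕ → Bool) : Bool :=
  addFace (!s) b c (faceKey d u b c) sl pos neg fun sl pos neg =>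
  addFace (!s) a b (faceKey d u a b) sl pos neg fun sl pos neg =>
  addFace s a c (faceKey d u a c) sl pos neg fun sl pos neg =>
  addFace s b c (faceKey (Nat.succ d) (refl7 a u) b c) sl pos neg fun sl pos neg =>
  addFace s a b (faceKey (Nat.succ d) (refl7 c u) (refl7 c a) (refl7 c b)) sl pos neg
    fun sl pos neg =>
  addFace (!s) (refl7 b a) c (faceKey (Nat.succ d) (refl7 b u) (refl7 b a) c) sl pos neg cont

noncomputable def all7 (p : ℕ → Bool) : Bool :=
  ite' (p (nat_lit 0)) (ite' (p (nat_lit 1)) (ite' (p (nat_lit 2)) (ite' (p (nat_lit 3))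
    (ite' (p (nat_lit 4)) (ite' (p (nat_lit 5)) (p (nat_lit 6)) false) false) false) false)
    false) false

/-- `(c - a) / (b - a)` modulo `7`. -/
def ratio (a b c : ℕ) : ℕ :=
  Nat.mod (Nat.mul (Nat.add c (Nat.sub (nat_lit 7) a))
    (Nat.pow (Nat.add b (Nat.sub (nat_lit 7) a)) (nat_lit 5))) (nat_lit 7)

/-- The Mochizuki cocycle on representatives in `{0, …, 6}`. -/
def zetaNat (a b c : ℕ) : ℕ :=
  ((a + 7 - b) * ((b ^ 7 + (2 * c + 7 - b) ^ 7 - 2 * c ^ 7) / 7)) % 7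

/-- The value of the cocycle on the image of a chain under `x ↦ m x + r`. -/
def zetaSum (m r : ℕ) (P : List (Bool × NTerm)) : ℕ :=
  P.foldr (fun x acc => (bif x.1 then 1 else 6) *
    zetaNat ((m * x.2.a + r) % 7) ((m * x.2.b + r) % 7) ((m * x.2.c + r) % 7) + acc) 0

noncomputable def leafCheck (P : List (Bool × NTerm)) : Bool :=
  all7 fun m => all7 fun r => Nat.beq (zetaSum m r P % 7) 0

abbrev SearchState := List ℕ → List ℕ → List (Bool × NTerm) → Bool

/-- The term with the opposite sign occurs in `P`. -/
def oppMem (P : List (Bool × NTerm)) (s : Bool) (d u a b c : ℕ) : Bool :=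
  P.any fun x => (x.1 ^^ s) && (Nat.beq x.2.a a && (Nat.beq x.2.b b && (Nat.beq x.2.c c &&
    (Nat.beq x.2.u u && Nat.beq x.2.d d))))

noncomputable def tryTerm (c₀ : ℕ) (go : SearchState) (sl : ℕ) (pos neg : List ℕ)
    (P : List (Bool × NTerm)) (s : Bool) (d u a b c : ℕ) : Bool :=
  ite' (Nat.beq a b) true <| ite' (Nat.beq b c) true <|
  ite' (Nat.rec (Nat.ble (Nat.succ c₀) (ratio a b c)) (fun _ _ => false) d) true <|
  addTerm s d u a b c sl pos neg fun _ pos neg =>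
    ite' (oppMem P s d u a b c) true (go pos neg ((s, ⟨d, u, a, b, c⟩) :: P))

/-- Try all terms that have the face `(d, u; x, y)` with sign `s`. -/
noncomputable def expand (tr : Bool → ℕ → ℕ → ℕ → ℕ → ℕ → Bool) (s : Bool) (d u x y : ℕ) : Bool :=
  all7 fun e =>
    ite' (tr (!s) d u e x y) (ite' (tr s d u x e y) (ite' (tr (!s) d u x y e)
    (Nat.rec true (fun d _ =>
      ite' (tr s d (refl7 e u) e x y) (ite'
       (tr (!s) d (refl7 e u) (refl7 e x) e y)
       (tr s d (refl7 e u) (refl7 e x) (refl7 e y) e) false) false) d) false) false) false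

noncomputable def step (c₀ k : ℕ) (go : SearchState) : SearchState := fun pos neg P =>
  force (Nat.add (lenK pos) (lenK neg)) fun n =>
  ite' (Nat.beq n (nat_lit 0)) (leafCheck P) <|
  ite' (Nat.ble n (6 * (k + 1)))
    (force (minK neg (minK pos 10000)) fun m =>
      force (Nat.div (6 * k + 6 - n) 2) fun sl =>
      force (m / 343) fun d => force (m / 49 % 7) fun u => force (m / 7 % 7) fun x =>
      force (m % 7) fun y =>
      ite' (memK m pos)
        (expand (tryTerm c₀ go sl pos neg P) false d u x y)
        (ite' (memK m neg) (expand (tryTerm c₀ go sl pos neg P) true d u x y) false))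
    true

/-- Search for all completions by at most `k` further terms. -/
noncomputable def search (c₀ k : ℕ) : SearchState :=
  Nat.rec (fun pos neg P => ite' (Nat.beq (Nat.add (lenK pos) (lenK neg)) (nat_lit 0))
    (leafCheck P) true) (fun k go => step c₀ k go) k

/-- Search for cycles starting with the term `((0, 0); 0, 1, c₀)`. -/
noncomputable def searchFrom (c₀ : ℕ) : Bool :=
  tryTerm c₀ (search c₀ 6) 50 [] [] [] true 0 0 0 1 c₀

end Search

theorem searchFrom_0 : searchFrom 0 = true := by decide +kernel

theorem searchFrom_2 : searchFrom 2 = true := by decide +kernel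

theorem searchFrom_3 : searchFrom 3 = true := by decide +kernel

theorem searchFrom_4 : searchFrom 4 = true := by decide +kernel

theorem searchFrom_5 : searchFrom 5 = true := by decide +kernel

theorem searchFrom_6 : searchFrom 6 = true := by decide +kernel

/-! ### Terms and boundaries over `ZMod 7` -/

section Soundness

/-- A term `((d, u); a, b, c)` of a chain of `(R₇, ℤ × R₇)`. -/
@[ext] structure Term where
  d : ℤ
  u : ZMod 7
  a : ZMod 7
  b : ZMod 7
  c : ZMod 7

/-- Test functions on faces `((d, u); x, y)`. -/
abbrev FaceFun := ℤ → ZMod 7 → ZMod 7 → ZMod 7 → ℤ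

def faceVal (F : FaceFun) (d : ℤ) (u x y : ZMod 7) : ℤ := if x = y then 0 else F d u x y

/-- The value of a test function on the boundary of a term. -/
def bdVal (F : FaceFun) (t : Term) : ℤ :=
  -faceVal F t.d t.u t.b t.c + (-faceVal F t.d t.u t.a t.b + (faceVal F t.d t.u t.a t.c +
    (faceVal F (t.d + 1) (2 * t.a - t.u) t.b t.c +
    (faceVal F (t.d + 1) (2 * t.c - t.u) (2 * t.c - t.a) (2 * t.c - t.b) +
    -faceVal F (t.d + 1) (2 * t.b - t.u) (2 * t.b - t.a) t.c))))

def sgn (s : Bool) : ℤ := if s then 1 else -1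

lemma sgn_not (s : Bool) : sgn (!s) = -sgn s := by cases s <;> simp [sgn]

/-- A signed multiset of terms. -/
abbrev Signed := Multiset (Bool × Term)

def bdSum (F : FaceFun) (L : Signed) : ℤ := (L.map fun x => sgn x.1 * bdVal F x.2).sum

@[simp] lemma bdSum_zero (F : FaceFun) : bdSum F 0 = 0 := rfl

@[simp] lemma bdSum_cons (F : FaceFun) (x : Bool × Term) (L : Signed) :
    bdSum F (x ::ₘ L) = sgn x.1 * bdVal F x.2 + bdSum F L := by simp [bdSum]

def IsCycle (L : Signed) : Prop := ∀ F, bdSum F L = 0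

/-- Value of the Mochizuki cocycle on the image of a term under `x ↦ m x + r`. -/
def zetaTerm (m r : ZMod 7) (x : Bool × Term) : ZMod 7 :=
  (sgn x.1 : ZMod 7) * zetaFun (m * x.2.a + r) (m * x.2.b + r) (m * x.2.c + r)

def zetaSigned (m r : ZMod 7) (L : Signed) : ZMod 7 := (L.map (zetaTerm m r)).sum

@[simp] lemma zetaSigned_zero (m r : ZMod 7) : zetaSigned m r 0 = 0 := rfl

@[simp] lemma zetaSigned_cons (m r : ZMod 7) (x : Bool × Term) (L : Signed) :
    zetaSigned m r (x ::ₘ L) = zetaTerm m r x + zetaSigned m r L := by simp [zetaSigned]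

def FaceFun.Bounded (F : FaceFun) : Prop := ∀ d u x y, |F d u x y| ≤ 1

lemma FaceFun.Bounded.faceVal_le {F : FaceFun} (hF : F.Bounded) (d : ℤ) (u x y : ZMod 7) :
    |faceVal F d u x y| ≤ 1 := by
  unfold faceVal
  split_ifs
  · simp
  · exact hF ..

lemma abs_sgn_mul (s : Bool) (z : ℤ) : |sgn s * z| = |z| := by cases s <;> simp [sgn]

lemma FaceFun.Bounded.bdVal_le {F : FaceFun} (hF : F.Bounded) (t : Term) : |bdVal F t| ≤ 6 := by
  have h := hF.faceVal_le
  have h1 := abs_le.1 (h t.d t.u t.b t.c)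
  have h2 := abs_le.1 (h t.d t.u t.a t.b)
  have h3 := abs_le.1 (h t.d t.u t.a t.c)
  have h4 := abs_le.1 (h (t.d + 1) (2 * t.a - t.u) t.b t.c)
  have h5 := abs_le.1 (h (t.d + 1) (2 * t.c - t.u) (2 * t.c - t.a) (2 * t.c - t.b))
  have h6 := abs_le.1 (h (t.d + 1) (2 * t.b - t.u) (2 * t.b - t.a) t.c)
  unfold bdVal
  rw [abs_le]
  omega

lemma FaceFun.Bounded.bdSum_le {F : FaceFun} (hF : F.Bounded) (L : Signed) :
    |bdSum F L| ≤ 6 * L.card := by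
  induction L using Multiset.induction with
  | empty => simp
  | cons x L ih =>
    have h1 := abs_sgn_mul x.1 (bdVal F x.2)
    have h2 := hF.bdVal_le x.2
    have h3 := abs_add_le (sgn x.1 * bdVal F x.2) (bdSum F L)
    rw [bdSum_cons, Multiset.card_cons]
    push_cast
    linarith

/-! ### Decoding of search data -/

def keyVal (F : FaceFun) (k : ℕ) : ℤ :=
  F (k / 343 : ℕ) ((k / 49 : ℕ) : ZMod 7) ((k / 7 : ℕ) : ZMod 7) (k : ZMod 7)

def keySum (F : FaceFun) (l : List ℕ) : ℤ := (l.map (keyVal F)).sum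

@[simp] lemma keySum_nil (F : FaceFun) : keySum F [] = 0 := rfl

@[simp] lemma keySum_cons (F : FaceFun) (k : ℕ) (l : List ℕ) :
    keySum F (k :: l) = keyVal F k + keySum F l := by simp [keySum]

def NTerm.toTerm (t : NTerm) : Term := ⟨t.d, t.u, t.a, t.b, t.c⟩

lemma keyVal_faceKey (F : FaceFun) {d u x y : ℕ} (hu : u < 7) (hx : x < 7) (hy : y < 7) :
    keyVal F (faceKey d u x y) = F d u x y := by
  have e : faceKey d u x y = ((d * 7 + u) * 7 + x) * 7 + y := rfl
  have h1 : faceKey d u x y / 343 = d := by omega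
  have h2 : faceKey d u x y / 49 = d * 7 + u := by omega
  have h3 : faceKey d u x y / 7 = (d * 7 + u) * 7 + x := by omega
  have h7 : (7 : ZMod 7) = 0 := rfl
  unfold keyVal
  rw [h1, h2, h3, e]
  push_cast
  simp [h7]

@[simp] lemma force_eq (n : ℕ) (f : ℕ → Bool) : force n f = f n := by cases n <;> rfl

lemma ite'_eq {α : Type} (b : Bool) (t e : α) : ite' b t e = if b then t else e := by
  cases b <;> rfl

lemma natBeq_iff (a b : ℕ) : Nat.beq a b = true ↔ a = b := by
  constructor
  · exact Nat.eq_of_beq_eq_true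
  · rintro rfl; exact Nat.beq_refl a

lemma memK_iff (k : ℕ) (l : List ℕ) : memK k l = true ↔ k ∈ l := by
  induction l with
  | nil => simp [memK]
  | cons x l ih =>
    have : memK k (x :: l) = ite' (Nat.beq x k) true (memK k l) := rfl
    rw [this, ite'_eq]
    by_cases h : Nat.beq x k = true
    · simp [(natBeq_iff _ _).1 h]
    · have h' : k ≠ x := fun e => h ((natBeq_iff _ _).2 e.symm)
      simp [h, ih, h']

lemma lenK_eq (l : List ℕ) : lenK l = l.length := by
  induction l with
  | nil => rfl
  | cons x l ih =>
    have : lenK (x :: l) = Nat.succ (lenK l) := rfl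
    rw [this, ih]; rfl

lemma eraseK_eq (k : ℕ) (l : List ℕ) : eraseK k l = l.erase k := by
  induction l with
  | nil => rfl
  | cons x l ih =>
    have : eraseK k (x :: l) = ite' (Nat.beq x k) l (x :: eraseK k l) := rfl
    rw [this, ite'_eq, ih, List.erase_cons]
    by_cases h : Nat.beq x k = true
    · simp [(natBeq_iff _ _).1 h]
    · have h' : x ≠ k := fun e => h ((natBeq_iff _ _).2 e)
      simp [h, h']

lemma keySum_erase (F : FaceFun) {k : ℕ} {l : List ℕ} (h : k ∈ l) :
    keySum F l = keyVal F k + keySum F (l.erase k) := by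
  rw [← keySum_cons]
  exact ((List.perm_cons_erase h).map _).sum_eq

lemma all7_iff (p : ℕ → Bool) : all7 p = true ↔ ∀ e < 7, p e = true := by
  simp only [all7, ite'_eq]
  constructor
  · intro h e he
    interval_cases e <;> grind
  · intro h
    simp [h]

lemma refl7_inj (x : ℕ) {y z : ℕ} (hy : y < 7) (hz : z < 7) : refl7 x y = refl7 x z ↔ y = z := by
  change (2 * x + (7 - y)) % 7 = (2 * x + (7 - z)) % 7 ↔ y = z
  omega

lemma refl7_lt (x y : ℕ) : refl7 x y < 7 := Nat.mod_lt _ (by norm_num)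

lemma cast_refl7 (x : ℕ) {y : ℕ} (hy : y < 7) :
    ((refl7 x y : ℕ) : ZMod 7) = 2 * x - y := by
  have e : refl7 x y = (2 * x + (7 - y)) % 7 := rfl
  have h7 : (7 : ZMod 7) = 0 := rfl
  rw [e, ZMod.natCast_mod]
  push_cast [Nat.cast_sub hy.le]
  rw [h7]
  ring

/-! ### Soundness of the boundary update -/

lemma exists_bounded_test {pos neg : List ℕ} (hd : ∀ k ∈ pos, k ∉ neg) :
    ∃ F : FaceFun, F.Bounded ∧ keySum F pos = pos.length ∧ keySum F neg = -neg.length := by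
  classical
  let enc : ℤ → ZMod 7 → ZMod 7 → ZMod 7 → ℕ := fun d u x y => faceKey d.toNat u.val x.val y.val
  let F : FaceFun := fun d u x y =>
    if enc d u x y ∈ pos then 1 else if enc d u x y ∈ neg then -1 else 0
  have hF : ∀ k, keyVal F k = if k ∈ pos then 1 else if k ∈ neg then -1 else 0 := by
    intro k
    have : enc (k / 343 : ℕ) ((k / 49 : ℕ) : ZMod 7) ((k / 7 : ℕ) : ZMod 7) (k : ZMod 7) = k := by
      simp only [enc, ZMod.val_natCast, Int.toNat_natCast]
      change ((k / 343 * 7 + k / 49 % 7) * 7 + k / 7 % 7) * 7 + k % 7 = k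
      omega
    simp only [keyVal, F, this]
  refine ⟨F, ?_, ?_, ?_⟩
  · intro d u x y
    simp only [F]
    split_ifs <;> simp
  · have : pos.map (keyVal F) = pos.map fun _ => 1 :=
      List.map_congr_left fun k hk => by simp [hF, hk]
    simp [keySum, this]
  · have : neg.map (keyVal F) = neg.map fun _ => -1 :=
      List.map_congr_left fun k hk => by
        have : k ∉ pos := fun h => hd k h hk
        simp [hF, hk, this]
    simp [keySum, this]

lemma length_le_of_bounded {pos neg : List ℕ} (hd : ∀ k ∈ pos, k ∉ neg) {R : FaceFun → ℤ} {B : ℤ}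
    (hR : ∀ F, F.Bounded → |R F| ≤ B) (h : ∀ F, keySum F pos - keySum F neg + R F = 0) :
    (pos.length + neg.length : ℤ) ≤ B := by
  obtain ⟨F, hF, h1, h2⟩ := exists_bounded_test hd
  have h3 := h F
  have h4 := abs_le.1 (hR F hF)
  omega

lemma addFace_sound {s : Bool} {d u x y x' y' sl B : ℕ} {pos neg : List ℕ}
    {cont : ℕ → List ℕ → List ℕ → Bool} {R : FaceFun → ℤ} {j : ℕ}
    (h : addFace s x' y' (faceKey d u x y) sl pos neg cont = true) (hxy' : x' = y' ↔ x = y)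
    (hu : u < 7) (hx : x < 7) (hy : y < 7)
    (hd : ∀ k ∈ pos, k ∉ neg)
    (hR : ∀ F : FaceFun, F.Bounded → |R F| ≤ (B + j : ℕ))
    (hs : B + (j + 1) ≤ 2 * sl + (pos.length + neg.length) + 1)
    (he : ∀ F, keySum F pos - keySum F neg + (sgn s * faceVal F d u x y + R F) = 0) :
    ∃ sl' pos' neg', cont sl' pos' neg' = true ∧ (∀ k ∈ pos', k ∉ neg') ∧
      B + j ≤ 2 * sl' + (pos'.length + neg'.length) + 1 ∧
      ∀ F, keySum F pos' - keySum F neg' + R F = 0 := by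
  simp only [addFace, ite'_eq, force_eq, natBeq_iff, memK_iff, eraseK_eq, hxy'] at h
  by_cases hxy : x = y
  · rw [if_pos hxy] at h
    refine ⟨sl, pos, neg, h, hd, by omega, fun F => ?_⟩
    simpa [faceVal, hxy] using he F
  rw [if_neg hxy] at h
  have hxy7 : (x : ZMod 7) ≠ y := by
    intro e
    have := congrArg ZMod.val e
    rw [ZMod.val_natCast, ZMod.val_natCast] at this
    omega
  set k := faceKey d u x y with hk
  have hF : ∀ F, faceVal F d u x y = keyVal F k := fun F => by
    rw [hk, keyVal_faceKey F hu hx hy, faceVal, if_neg hxy7]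
  simp only [hF] at he
  have hbd : ∀ pos' neg' : List ℕ, (∀ k ∈ pos', k ∉ neg') →
      (∀ F, keySum F pos' - keySum F neg' + R F = 0) →
      pos'.length + neg'.length ≤ B + j := fun pos' neg' h1 h2 => by
    exact_mod_cast length_le_of_bounded h1 hR h2
  cases s
  · simp only [Bool.false_eq_true, if_false] at h
    simp only [sgn, Bool.false_eq_true, if_false] at he
    by_cases hm : k ∈ pos
    · rw [if_pos hm] at h
      have hl := List.length_erase_of_mem hm
      have hp := List.length_pos_of_mem hm
      refine ⟨sl, _, neg, h, fun i hi => hd i (List.mem_of_mem_erase hi), by omega, fun F => ?_⟩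
      have := he F
      rw [keySum_erase F hm] at this
      linarith
    · rw [if_neg hm] at h
      have hd' : ∀ i ∈ pos, i ∉ k :: neg := fun i hi => by
        have : i ≠ k := fun e => hm (e ▸ hi)
        simp [this, hd i hi]
      have he' : ∀ F, keySum F pos - keySum F (k :: neg) + R F = 0 := fun F => by
        rw [keySum_cons, ← he F]; ring
      cases sl with
      | zero =>
        have := hbd _ _ hd' he'
        simp only [List.length_cons] at this
        omega
      | succ sl => exact ⟨sl, pos, k :: neg, h, hd', by simp only [List.length_cons]; omega, he'⟩
  · simp only [if_true] at h
    simp only [sgn, if_true] at he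
    by_cases hm : k ∈ neg
    · rw [if_pos hm] at h
      have hl := List.length_erase_of_mem hm
      have hp := List.length_pos_of_mem hm
      refine ⟨sl, pos, _, h, fun i hi hi' => hd i hi (List.mem_of_mem_erase hi'), by omega,
        fun F => ?_⟩
      have := he F
      rw [keySum_erase F hm] at this
      linarith
    · rw [if_neg hm] at h
      have hd' : ∀ i ∈ k :: pos, i ∉ neg := fun i hi => by
        rcases List.mem_cons.1 hi with rfl | hi
        · exact hm
        · exact hd i hi
      have he' : ∀ F, keySum F (k :: pos) - keySum F neg + R F = 0 := fun F => by
        rw [keySum_cons, ← he F]; ring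
      cases sl with
      | zero =>
        have := hbd _ _ hd' he'
        simp only [List.length_cons] at this
        omega
      | succ sl => exact ⟨sl, k :: pos, neg, h, hd', by simp only [List.length_cons]; omega, he'⟩

lemma bounded_add_face {R : FaceFun → ℤ} {n : ℕ} (hR : ∀ F : FaceFun, F.Bounded → |R F| ≤ n)
    (s : Bool) (d : ℤ) (u x y : ZMod 7) (F : FaceFun) (hF : F.Bounded) :
    |sgn s * faceVal F d u x y + R F| ≤ (n + 1 : ℕ) := by
  have h1 := abs_add_le (sgn s * faceVal F d u x y) (R F)
  rw [abs_sgn_mul] at h1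
  have h2 := hF.faceVal_le d u x y
  have h3 := hR F hF
  push_cast
  linarith

lemma addTerm_sound {s : Bool} {d u a b c sl B : ℕ} {pos neg : List ℕ}
    {cont : ℕ → List ℕ → List ℕ → Bool} {R : FaceFun → ℤ}
    (h : addTerm s d u a b c sl pos neg cont = true)
    (hu : u < 7) (ha : a < 7) (hb : b < 7) (hc : c < 7)
    (hd : ∀ k ∈ pos, k ∉ neg)
    (hR : ∀ F : FaceFun, F.Bounded → |R F| ≤ B)
    (hs : B + 6 ≤ 2 * sl + (pos.length + neg.length) + 1)
    (he : ∀ F, keySum F pos - keySum F neg +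
      (sgn s * bdVal F (NTerm.toTerm ⟨d, u, a, b, c⟩) + R F) = 0) :
    ∃ sl' pos' neg', cont sl' pos' neg' = true ∧ (∀ k ∈ pos', k ∉ neg') ∧
      ∀ F, keySum F pos' - keySum F neg' + R F = 0 := by
  have b0 : ∀ F : FaceFun, F.Bounded → |R F| ≤ (B + 0 : ℕ) := hR
  have b1 := bounded_add_face b0 (!s) (d + 1 : ℕ) (refl7 b u : ℕ) (refl7 b a : ℕ) (c : ℕ)
  have b2 := bounded_add_face b1 s (d + 1 : ℕ) (refl7 c u : ℕ) (refl7 c a : ℕ) (refl7 c b : ℕ)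
  have b3 := bounded_add_face b2 s (d + 1 : ℕ) (refl7 a u : ℕ) (b : ℕ) (c : ℕ)
  have b4 := bounded_add_face b3 s (d : ℕ) (u : ℕ) (a : ℕ) (c : ℕ)
  have b5 := bounded_add_face b4 (!s) (d : ℕ) (u : ℕ) (a : ℕ) (b : ℕ)
  unfold addTerm at h
  obtain ⟨sl, pos, neg, h, hd, hs, he⟩ := addFace_sound h Iff.rfl hu hb hc hd b5 hs (fun F => by
    rw [← he F]
    simp only [bdVal, NTerm.toTerm, sgn_not, cast_refl7 _ hu, cast_refl7 _ ha, cast_refl7 _ hb]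
    push_cast
    ring)
  obtain ⟨sl, pos, neg, h, hd, hs, he⟩ := addFace_sound h Iff.rfl hu ha hb hd b4 hs he
  obtain ⟨sl, pos, neg, h, hd, hs, he⟩ := addFace_sound h Iff.rfl hu ha hc hd b3 hs he
  obtain ⟨sl, pos, neg, h, hd, hs, he⟩ := addFace_sound h Iff.rfl (refl7_lt _ _) hb hc hd b2 hs he
  obtain ⟨sl, pos, neg, h, hd, hs, he⟩ := addFace_sound h (refl7_inj c ha hb).symm (refl7_lt _ _)
    (refl7_lt _ _) (refl7_lt _ _) hd b1 hs he
  obtain ⟨sl, pos, neg, h, hd, hs, he⟩ := addFace_sound h Iff.rfl (refl7_lt _ _) (refl7_lt _ _) hc hd b0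
    hs he
  exact ⟨sl, pos, neg, h, hd, he⟩

/-! ### Soundness of the final check -/

lemma cast_zetaNat : ∀ a b c : ZMod 7,
    ((zetaNat a.val b.val c.val : ℕ) : ZMod 7) = zetaFun a b c := by decide +kernel

lemma ratio_val : ∀ a b c : ZMod 7,
    ratio a.val b.val c.val = ((c - a) * (b - a) ^ 5).val := by decide +kernel

def decodeList (P : List (Bool × NTerm)) : Signed := (P.map fun x => (x.1, x.2.toTerm) :)

lemma cast_zetaSum (m r : ℕ) (P : List (Bool × NTerm)) :
    ((zetaSum m r P : ℕ) : ZMod 7) = zetaSigned m r (decodeList P) := by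
  induction P with
  | nil => simp [zetaSum, decodeList]
  | cons x P ih =>
    have e : decodeList (x :: P) = (x.1, x.2.toTerm) ::ₘ decodeList P := rfl
    have e' : zetaSum m r (x :: P) = (bif x.1 then 1 else 6) *
      zetaNat ((m * x.2.a + r) % 7) ((m * x.2.b + r) % 7) ((m * x.2.c + r) % 7) +
        zetaSum m r P := rfl
    have h6 : (6 : ZMod 7) = -1 := rfl
    have hz := cast_zetaNat (m * x.2.a + r) (m * x.2.b + r) (m * x.2.c + r)
    have hv : ∀ a : ℕ, (m * a + r : ZMod 7).val = (m * a + r) % 7 := fun a => by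
      rw [← ZMod.val_natCast]; push_cast; rfl
    rw [hv, hv, hv] at hz
    rw [e, e', zetaSigned_cons, ← ih]
    simp only [Nat.cast_add, Nat.cast_mul, hz, zetaTerm, NTerm.toTerm, add_left_inj]
    cases x.1 <;> simp [sgn, h6]

lemma leafCheck_sound {P : List (Bool × NTerm)} (h : leafCheck P = true) (m r : ZMod 7) :
    zetaSigned m r (decodeList P) = 0 := by
  rw [leafCheck, all7_iff] at h
  have h1 := h m.val m.val_lt
  rw [all7_iff] at h1
  have h2 := (natBeq_iff _ _).1 (h1 r.val r.val_lt)
  have h3 := cast_zetaSum m.val r.val P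
  rw [ZMod.natCast_zmod_val, ZMod.natCast_zmod_val] at h3
  rw [← h3, ← ZMod.natCast_mod, h2]
  rfl

/-! ### Soundness of the search -/

def Term.ratio (t : Term) : ℕ := QHom.ratio t.a.val t.b.val t.c.val

def Term.Nondeg (t : Term) : Prop := t.a ≠ t.b ∧ t.b ≠ t.c

/-- No two terms cancel each other. -/
def NoCancel (L : Signed) : Prop := ∀ x ∈ L, ∀ y ∈ L, x.2 = y.2 → x.1 = y.1

/-- Normalised terms: minimal degree `0`, where the ratio is at most `c₀`. -/
def Term.Admissible (c₀ : ℕ) (t : Term) : Prop := 0 ≤ t.d ∧ t.Nondeg ∧ (t.d = 0 → t.ratio ≤ c₀)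

/-- Up to a smaller cycle, the cocycle vanishes on `P + L`. -/
def Reducible (P : List (Bool × NTerm)) (L : Signed) : Prop :=
  ∃ L' ≤ L, IsCycle L' ∧ ∀ m r, zetaSigned m r (decodeList P + L) = zetaSigned m r L'

def SearchState.Sound (c₀ k : ℕ) (go : SearchState) : Prop :=
  ∀ pos neg P, go pos neg P = true → ∀ L : Signed, L.card ≤ k → (∀ x ∈ L, x.2.Admissible c₀) →
    NoCancel (decodeList P + L) → (∀ i ∈ pos, i ∉ neg) →
    (∀ F, keySum F pos - keySum F neg + bdSum F L = 0) → Reducible P L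

lemma reducible_of_leaf {P : List (Bool × NTerm)} (h : leafCheck P = true) {L : Signed}
    (hL : IsCycle L) : Reducible P L :=
  ⟨L, le_rfl, hL, fun m r => by
    have := leafCheck_sound h m r
    simp only [zetaSigned, Multiset.map_add, Multiset.sum_add] at this ⊢
    rw [this, zero_add]⟩

lemma tryTerm_sound {c₀ k : ℕ} {go : SearchState} (hgo : go.Sound c₀ k) {sl : ℕ}
    {pos neg : List ℕ} {P : List (Bool × NTerm)} {s : Bool} {d u a b c : ℕ}
    (h : tryTerm c₀ go sl pos neg P s d u a b c = true)
    (hu : u < 7) (ha : a < 7) (hb : b < 7) (hc : c < 7)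
    (hs : 6 * k + 6 ≤ 2 * sl + (pos.length + neg.length) + 1)
    {L : Signed} (hL : L.card ≤ k) (hadm : ∀ x ∈ L, x.2.Admissible c₀)
    (hadm' : (NTerm.toTerm ⟨d, u, a, b, c⟩).Admissible c₀)
    (hcan : NoCancel (decodeList P + (s, NTerm.toTerm ⟨d, u, a, b, c⟩) ::ₘ L))
    (hd : ∀ i ∈ pos, i ∉ neg)
    (he : ∀ F, keySum F pos - keySum F neg +
      bdSum F ((s, NTerm.toTerm ⟨d, u, a, b, c⟩) ::ₘ L) = 0) :
    Reducible ((s, ⟨d, u, a, b, c⟩) :: P) L := by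
  obtain ⟨-, ⟨hab, hbc⟩, hrat⟩ := hadm'
  have hval : ∀ n : ℕ, n < 7 → (n : ZMod 7).val = n := fun n hn => ZMod.val_cast_of_lt hn
  have hab' : a ≠ b := fun e => hab (by simp [NTerm.toTerm, e])
  have hbc' : b ≠ c := fun e => hbc (by simp [NTerm.toTerm, e])
  simp only [tryTerm, ite'_eq, natBeq_iff, if_neg hab', if_neg hbc'] at h
  have hno : (Nat.rec (Nat.ble (Nat.succ c₀) (ratio a b c)) (fun _ _ => false) d : Bool) = false := by
    cases d with
    | zero =>
      have := hrat rfl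
      simp only [Term.ratio, NTerm.toTerm, hval a ha, hval b hb, hval c hc] at this
      change Nat.ble (Nat.succ c₀) (ratio a b c) = false
      rw [← Bool.not_eq_true, Nat.ble_eq]
      omega
    | succ d => rfl
  rw [hno] at h
  simp only [Bool.false_eq_true, if_false] at h
  obtain ⟨_, pos', neg', h, hd', he'⟩ := addTerm_sound (B := 6 * k) (R := fun F => bdSum F L) h
    hu ha hb hc hd (fun F hF => (hF.bdSum_le L).trans (by exact_mod_cast Nat.mul_le_mul_left 6 hL))
    hs (fun F => by rw [← he F, bdSum_cons])
  have hopp : oppMem P s d u a b c = false := by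
    rw [← Bool.not_eq_true]
    intro ho
    simp only [oppMem, List.any_eq_true, Bool.and_eq_true, natBeq_iff] at ho
    obtain ⟨⟨s', t⟩, hx, hs', h1, h2, h3, h4, h5⟩ := ho
    have hm : (s', t.toTerm) ∈ decodeList P := by
      simp only [decodeList, Multiset.mem_coe, List.mem_map]
      exact ⟨_, hx, rfl⟩
    have := hcan (s', t.toTerm) (Multiset.mem_add.2 (Or.inl hm)) (s, NTerm.toTerm ⟨d, u, a, b, c⟩)
      (Multiset.mem_add.2 (Or.inr (Multiset.mem_cons_self _ _)))
      (by simp only at h1 h2 h3 h4 h5; simp [NTerm.toTerm, h1, h2, h3, h4, h5])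
    simp only at this hs'
    simp [this] at hs'
  rw [hopp] at h
  simp only [Bool.false_eq_true, if_false] at h
  refine hgo _ _ _ h L hL hadm ?_ hd' he'
  have : decodeList ((s, ⟨d, u, a, b, c⟩) :: P) + L =
      decodeList P + (s, NTerm.toTerm ⟨d, u, a, b, c⟩) ::ₘ L := by
    have : decodeList ((s, ⟨d, u, a, b, c⟩) :: P) =
      (s, NTerm.toTerm ⟨d, u, a, b, c⟩) ::ₘ decodeList P := rfl
    rw [this, Multiset.cons_add, Multiset.add_cons]
  rw [this]
  exact hcan

/-- The face `((d, u); x, y)` occurs in the boundary of the term `t` taken with sign `s`, with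
sign `s'`. -/
def IsFaceOf (d : ℤ) (u x y : ZMod 7) (s' s : Bool) (t : Term) : Prop :=
  (s = !s' ∧ ((t.d = d ∧ t.u = u ∧ t.b = x ∧ t.c = y) ∨ (t.d = d ∧ t.u = u ∧ t.a = x ∧ t.b = y) ∨
    (t.d + 1 = d ∧ 2 * t.b - t.u = u ∧ 2 * t.b - t.a = x ∧ t.c = y))) ∨
  (s = s' ∧ ((t.d = d ∧ t.u = u ∧ t.a = x ∧ t.c = y) ∨
    (t.d + 1 = d ∧ 2 * t.a - t.u = u ∧ t.b = x ∧ t.c = y) ∨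
    (t.d + 1 = d ∧ 2 * t.c - t.u = u ∧ 2 * t.c - t.a = x ∧ 2 * t.c - t.b = y)))

/-- The indicator function of a face. -/
def faceInd (d : ℤ) (u x y : ZMod 7) : FaceFun := fun d' u' x' y' =>
  if d' = d ∧ u' = u ∧ x' = x ∧ y' = y then 1 else 0

lemma faceVal_faceInd (d : ℤ) (u x y : ZMod 7) (d' : ℤ) (u' x' y' : ZMod 7) :
    faceVal (faceInd d u x y) d' u' x' y' = 0 ∨ (faceVal (faceInd d u x y) d' u' x' y' = 1 ∧
      d' = d ∧ u' = u ∧ x' = x ∧ y' = y) := by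
  unfold faceVal faceInd
  split_ifs with h1 h2
  · exact Or.inl rfl
  · exact Or.inr ⟨rfl, h2⟩
  · exact Or.inl rfl

lemma isFaceOf_of_pos {d : ℤ} {u x y : ZMod 7} {s s' : Bool} {t : Term}
    (h : 0 < sgn s' * (sgn s * bdVal (faceInd d u x y) t)) : IsFaceOf d u x y s' s t := by
  have key : 0 < (if s = s' then bdVal (faceInd d u x y) t else -bdVal (faceInd d u x y) t) := by
    cases s <;> cases s' <;> simpa [sgn] using h
  have h' := faceVal_faceInd d u x y
  unfold bdVal at key
  unfold IsFaceOf
  have h1 := h' t.d t.u t.b t.c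
  have h2 := h' t.d t.u t.a t.b
  have h3 := h' t.d t.u t.a t.c
  have h4 := h' (t.d + 1) (2 * t.a - t.u) t.b t.c
  have h5 := h' (t.d + 1) (2 * t.c - t.u) (2 * t.c - t.a) (2 * t.c - t.b)
  have h6 := h' (t.d + 1) (2 * t.b - t.u) (2 * t.b - t.a) t.c
  by_cases hs : s = s'
  · rw [if_pos hs] at key
    refine Or.inr ⟨hs, ?_⟩
    rcases h3 with h3 | h3
    · rcases h4 with h4 | h4
      · rcases h5 with h5 | h5
        · omega
        · exact Or.inr (Or.inr h5.2)
      · exact Or.inr (Or.inl h4.2)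
    · exact Or.inl h3.2
  · rw [if_neg hs] at key
    refine Or.inl ⟨by cases s <;> cases s' <;> simp_all, ?_⟩
    rcases h1 with h1 | h1
    · rcases h2 with h2 | h2
      · rcases h6 with h6 | h6
        · omega
        · exact Or.inr (Or.inr h6.2)
      · exact Or.inr (Or.inl h2.2)
    · exact Or.inl h1.2

lemma exists_isFaceOf {d : ℤ} {u x y : ZMod 7} {s' : Bool} {L : Signed}
    (h : 0 < sgn s' * bdSum (faceInd d u x y) L) : ∃ z ∈ L, IsFaceOf d u x y s' z.1 z.2 := by
  by_contra! hne
  have : ∀ M ≤ L, sgn s' * bdSum (faceInd d u x y) M ≤ 0 := by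
    intro M
    induction M using Multiset.induction with
    | empty => simp
    | cons z M ih =>
      intro hM
      have h1 := ih ((Multiset.le_cons_self M z).trans hM)
      have h2 : sgn s' * (sgn z.1 * bdVal (faceInd d u x y) z.2) ≤ 0 := not_lt.1 fun hlt =>
        hne z (Multiset.mem_of_le hM (Multiset.mem_cons_self z M)) (isFaceOf_of_pos hlt)
      rw [bdSum_cons, mul_add]
      linarith
  exact absurd h (not_lt.2 (this L le_rfl))

lemma exists_of_expand {tr : Bool → ℕ → ℕ → ℕ → ℕ → ℕ → Bool} {s' : Bool} {d u x y : ℕ}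
    (h : expand tr s' d u x y = true) (hu : u < 7) (hx : x < 7) (hy : y < 7) {s : Bool} {t : Term}
    (ht : 0 ≤ t.d) (hf : IsFaceOf d u x y s' s t) :
    ∃ d u a b c : ℕ, u < 7 ∧ a < 7 ∧ b < 7 ∧ c < 7 ∧ tr s d u a b c = true ∧
      t = NTerm.toTerm ⟨d, u, a, b, c⟩ := by
  simp only [expand, all7_iff, ite'_eq, Bool.if_false_right, Bool.and_eq_true,
    decide_eq_true_eq] at h
  have hr : ∀ (e z : ZMod 7) (n : ℕ), n < 7 → 2 * e - z = n → z = (refl7 e.val n : ℕ) := by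
    intro e z n hn hz
    rw [cast_refl7 _ hn, ZMod.natCast_zmod_val, ← hz]
    ring
  have hv : ∀ e : ZMod 7, ((e.val : ℕ) : ZMod 7) = e := fun e => ZMod.natCast_zmod_val e
  rcases hf with ⟨rfl, ⟨h1, h2, h3, h4⟩ | ⟨h1, h2, h3, h4⟩ | ⟨h1, h2, h3, h4⟩⟩ |
      ⟨rfl, ⟨h1, h2, h3, h4⟩ | ⟨h1, h2, h3, h4⟩ | ⟨h1, h2, h3, h4⟩⟩
  · exact ⟨d, u, t.a.val, x, y, hu, t.a.val_lt, hx, hy, (h _ t.a.val_lt).1,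
      by ext1 <;> simp [NTerm.toTerm, *]⟩
  · exact ⟨d, u, x, y, t.c.val, hu, hx, hy, t.c.val_lt, (h _ t.c.val_lt).2.2.1,
      by ext1 <;> simp [NTerm.toTerm, *]⟩
  · obtain ⟨d, rfl⟩ : ∃ d', d = d' + 1 := ⟨d - 1, by omega⟩
    replace h e he := (h e he).2.2.2
    simp only [Bool.and_eq_true, decide_eq_true_eq] at h
    exact ⟨d, _, _, t.b.val, y, refl7_lt _ _, refl7_lt _ _, t.b.val_lt, hy,
      (h _ t.b.val_lt).2.1, Term.ext (by simp [NTerm.toTerm]; omega) (hr _ _ _ hu h2)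
        (hr _ _ _ hx h3) (hv _).symm h4⟩
  · exact ⟨d, u, x, t.b.val, y, hu, hx, t.b.val_lt, hy, (h _ t.b.val_lt).2.1,
      by ext1 <;> simp [NTerm.toTerm, *]⟩
  · obtain ⟨d, rfl⟩ : ∃ d', d = d' + 1 := ⟨d - 1, by omega⟩
    replace h e he := (h e he).2.2.2
    simp only [Bool.and_eq_true, decide_eq_true_eq] at h
    exact ⟨d, _, t.a.val, x, y, refl7_lt _ _, t.a.val_lt, hx, hy,
      (h _ t.a.val_lt).1, Term.ext (by simp [NTerm.toTerm]; omega) (hr _ _ _ hu h2)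
        (hv _).symm h3 h4⟩
  · obtain ⟨d, rfl⟩ : ∃ d', d = d' + 1 := ⟨d - 1, by omega⟩
    replace h e he := (h e he).2.2.2
    simp only [Bool.and_eq_true, decide_eq_true_eq] at h
    exact ⟨d, _, _, _, t.c.val, refl7_lt _ _, refl7_lt _ _, refl7_lt _ _, t.c.val_lt,
      (h _ t.c.val_lt).2.2, Term.ext (by simp [NTerm.toTerm]; omega) (hr _ _ _ hu h2)
        (hr _ _ _ hx h3) (hr _ _ _ hy h4) (hv _).symm⟩

/-- The indicator function of the face with key `m`. -/
def keyInd (m : ℕ) : FaceFun :=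
  faceInd (m / 343 : ℕ) (m / 49 % 7 : ℕ) (m / 7 % 7 : ℕ) (m % 7 : ℕ)

lemma keyVal_keyInd (m k : ℕ) : keyVal (keyInd m) k = if k = m then 1 else 0 := by
  unfold keyVal keyInd faceInd
  simp only [ZMod.natCast_mod, ZMod.natCast_eq_natCast_iff', Nat.cast_inj]
  congr 1
  rw [eq_iff_iff]
  constructor
  · rintro ⟨h1, h2, h3, h4⟩
    omega
  · rintro rfl
    simp

lemma keySum_keyInd (m : ℕ) (l : List ℕ) : keySum (keyInd m) l = l.count m := by
  induction l with
  | nil => simp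
  | cons k l ih =>
    rw [keySum_cons, keyVal_keyInd, ih, List.count_cons]
    by_cases h : k = m <;> simp [h, add_comm]

lemma Reducible.of_cons {P : List (Bool × NTerm)} {s : Bool} {n : NTerm} {L : Signed}
    (h : Reducible ((s, n) :: P) L) : Reducible P ((s, n.toTerm) ::ₘ L) := by
  obtain ⟨L', hL, hc, hz⟩ := h
  refine ⟨L', hL.trans (Multiset.le_cons_self _ _), hc, fun m r => ?_⟩
  rw [← hz]
  have : decodeList ((s, n) :: P) = (s, n.toTerm) ::ₘ decodeList P := rfl
  rw [this, Multiset.cons_add, Multiset.add_cons]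

lemma step_sound {c₀ k : ℕ} {go : SearchState} (hgo : go.Sound c₀ k) :
    SearchState.Sound c₀ (k + 1) (step c₀ k go) := by
  intro pos neg P h L hL hadm hcan hd he
  have hlen : pos.length + neg.length ≤ 6 * (k + 1) := by
    have := length_le_of_bounded (R := fun F => bdSum F L) (B := 6 * (k + 1)) hd
      (fun F hF => (hF.bdSum_le L).trans (by exact_mod_cast Nat.mul_le_mul_left 6 hL)) he
    exact_mod_cast this
  simp only [step, force_eq, ite'_eq, lenK_eq, natBeq_iff, Nat.add_eq] at h
  by_cases h0 : pos.length + neg.length = 0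
  · rw [if_pos h0] at h
    have hp : pos = [] := List.length_eq_zero_iff.1 (by omega)
    have hn : neg = [] := List.length_eq_zero_iff.1 (by omega)
    subst hp hn
    exact reducible_of_leaf h fun F => by simpa using he F
  rw [if_neg h0, if_pos (Nat.ble_eq_true_of_le hlen)] at h
  generalize minK neg (minK pos 10000) = m at h
  rw [show ∀ i j : ℕ, Nat.div i j = i / j from fun _ _ => rfl] at h
  have hex : ∀ s' : Bool, expand (tryTerm c₀ go ((6 * k + 6 - (pos.length + neg.length)) / 2)
      pos neg P) s' (m / 343) (m / 49 % 7) (m / 7 % 7) (m % 7) = true →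
      0 < sgn s' * (keySum (keyInd m) neg - keySum (keyInd m) pos) → Reducible P L := by
    intro s' h hpos
    rw [show keySum (keyInd m) neg - keySum (keyInd m) pos = bdSum (keyInd m) L by
      linarith [he (keyInd m)]] at hpos
    obtain ⟨z, hz, hf⟩ := exists_isFaceOf hpos
    obtain ⟨s, t⟩ := z
    obtain ⟨d, u, a, b, c, hu, ha, hb, hc, htr, rfl⟩ := exists_of_expand h
      (Nat.mod_lt _ (by norm_num)) (Nat.mod_lt _ (by norm_num)) (Nat.mod_lt _ (by norm_num))
      (hadm _ hz).1 hf
    obtain ⟨M, rfl⟩ := Multiset.exists_cons_of_mem hz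
    rw [Multiset.card_cons] at hL
    exact (tryTerm_sound hgo htr hu ha hb hc (by omega) (by omega)
      (fun x hx => hadm x (Multiset.mem_cons_of_mem hx)) (hadm _ hz) hcan hd he).of_cons
  simp only [memK_iff] at h
  simp only [keySum_keyInd] at hex
  by_cases hp : m ∈ pos
  · rw [if_pos hp] at h
    refine hex _ h ?_
    have h1 := List.count_pos_iff.2 hp
    have h2 := List.count_eq_zero.2 (hd m hp)
    rw [h2]
    simp [sgn, hp]
  · rw [if_neg hp] at h
    by_cases hn : m ∈ neg
    · rw [if_pos hn] at h
      refine hex _ h ?_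
      rw [List.count_eq_zero.2 hp]
      simp [sgn, hn]
    · rw [if_neg hn] at h
      exact absurd h (by simp)

lemma search_sound (c₀ k : ℕ) : SearchState.Sound c₀ k (search c₀ k) := by
  induction k with
  | zero =>
    intro pos neg P h L hL hadm hcan hd he
    obtain rfl : L = 0 := Multiset.card_eq_zero.1 (by omega)
    have hlen := length_le_of_bounded (R := fun _ => 0) (B := 0) hd (by simp) (by simpa using he)
    have hp : pos = [] := List.length_eq_zero_iff.1 (by omega)
    have hn : neg = [] := List.length_eq_zero_iff.1 (by omega)
    subst hp hn
    exact reducible_of_leaf h fun F => by simp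
  | succ k ih => exact step_sound ih

lemma searchFrom_sound {c₀ : ℕ} (hc : c₀ < 7) (h : searchFrom c₀ = true) {L : Signed}
    (hL : L.card ≤ 6)
    (hadm : ∀ x ∈ (true, NTerm.toTerm ⟨0, 0, 0, 1, c₀⟩) ::ₘ L, x.2.Admissible c₀)
    (hcan : NoCancel ((true, NTerm.toTerm ⟨0, 0, 0, 1, c₀⟩) ::ₘ L))
    (hcyc : IsCycle ((true, NTerm.toTerm ⟨0, 0, 0, 1, c₀⟩) ::ₘ L)) :
    Reducible [(true, ⟨0, 0, 0, 1, c₀⟩)] L :=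
  tryTerm_sound (search_sound c₀ 6) h (by norm_num) (by norm_num) (by norm_num) hc (by simp) hL
    (fun x hx => hadm x (Multiset.mem_cons_of_mem hx)) (hadm _ (Multiset.mem_cons_self _ _))
    (by simpa [decodeList] using hcan) (by simp) (fun F => by simpa using hcyc F)

/-! ### Normalisation -/

lemma fact_prime_seven : Fact (Nat.Prime 7) := ⟨by norm_num⟩

attribute [local instance] fact_prime_seven

/-- The sign `(-1) ^ d` in `ZMod 7`. -/
def paritySign (d : ℤ) : ZMod 7 := if Even d then 1 else -1

lemma paritySign_succ (d : ℤ) : paritySign (d + 1) = -paritySign d := by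
  unfold paritySign
  by_cases h : Even d <;> simp [h]

lemma paritySign_mul_self (d : ℤ) : paritySign d * paritySign d = 1 := by
  unfold paritySign
  split_ifs <;> simp

/-- An automorphism of the terms of `(R₇, ℤ × R₇)`, up to a shift of the degree. -/
def Term.move (μ r v : ZMod 7) (e : ℤ) (t : Term) : Term :=
  ⟨t.d - e, μ * t.u + r + paritySign t.d * v, μ * t.a + r, μ * t.b + r, μ * t.c + r⟩

lemma affine_inj {μ : ZMod 7} (hμ : μ ≠ 0) (r x y : ZMod 7) : μ * x + r = μ * y + r ↔ x = y := by
  rw [add_left_inj, mul_right_inj' hμ]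

lemma bdVal_move {μ : ZMod 7} (hμ : μ ≠ 0) (r v : ZMod 7) (e : ℤ) (F : FaceFun) (t : Term) :
    bdVal F (t.move μ r v e) = bdVal (fun d u x y =>
      F (d - e) (μ * u + r + paritySign d * v) (μ * x + r) (μ * y + r)) t := by
  have h1 : ∀ x u : ZMod 7, 2 * (μ * x + r) - (μ * u + r + paritySign t.d * v) =
      μ * (2 * x - u) + r + paritySign (t.d + 1) * v := fun x u => by rw [paritySign_succ]; ring
  have h2 : ∀ x y : ZMod 7, 2 * (μ * x + r) - (μ * y + r) = μ * (2 * x - y) + r :=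
    fun x y => by ring
  have h3 : t.d - e + 1 = t.d + 1 - e := by ring
  simp only [bdVal, Term.move, faceVal, h1, h2, h3, affine_inj hμ]

lemma Term.move_injective {μ : ZMod 7} (hμ : μ ≠ 0) (r v : ZMod 7) (e : ℤ) :
    Function.Injective (Term.move μ r v e) := by
  intro s t h
  simp only [Term.move, Term.mk.injEq, affine_inj hμ, sub_left_inj] at h
  obtain ⟨h1, h2, h3, h4, h5⟩ := h
  rw [h1, add_left_inj, affine_inj hμ] at h2
  exact Term.ext h1 h2 h3 h4 h5

lemma Term.Nondeg.move {t : Term} (h : t.Nondeg) {μ : ZMod 7} (hμ : μ ≠ 0) (r v : ZMod 7) (e : ℤ) :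
    (t.move μ r v e).Nondeg :=
  ⟨fun h' => h.1 ((affine_inj hμ ..).1 h'), fun h' => h.2 ((affine_inj hμ ..).1 h')⟩

lemma pow_six_eq_one : ∀ μ : ZMod 7, μ ≠ 0 → μ ^ 6 = 1 := by decide

lemma Term.ratio_eq (t : Term) : t.ratio = ((t.c - t.a) * (t.b - t.a) ^ 5).val := ratio_val _ _ _

lemma Term.ratio_move {μ : ZMod 7} (hμ : μ ≠ 0) (r v : ZMod 7) (e : ℤ) (t : Term) :
    (t.move μ r v e).ratio = t.ratio := by
  rw [Term.ratio_eq, Term.ratio_eq]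
  congr 1
  simp only [Term.move]
  linear_combination (t.c - t.a) * (t.b - t.a) ^ 5 * pow_six_eq_one μ hμ

/-- Apply an automorphism to all terms, and change all signs if `s = false`. -/
def Signed.move (s : Bool) (μ r v : ZMod 7) (e : ℤ) (L : Signed) : Signed :=
  L.map fun x => (x.1 == s, x.2.move μ r v e)

lemma sgn_beq (s s' : Bool) : sgn (s == s') = sgn s' * sgn s := by cases s <;> cases s' <;> rfl

lemma bdSum_move (s : Bool) {μ : ZMod 7} (hμ : μ ≠ 0) (r v : ZMod 7) (e : ℤ) (F : FaceFun)
    (L : Signed) : bdSum F (Signed.move s μ r v e L) = sgn s * bdSum (fun d u x y =>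
      F (d - e) (μ * u + r + paritySign d * v) (μ * x + r) (μ * y + r)) L := by
  simp only [bdSum, Signed.move, Multiset.map_map, Function.comp_def, bdVal_move hμ, sgn_beq,
    mul_assoc, Multiset.sum_map_mul_left]

lemma zetaSigned_move (s : Bool) (μ r v : ZMod 7) (e : ℤ) (m r' : ZMod 7) (L : Signed) :
    zetaSigned m r' (Signed.move s μ r v e L) =
      (sgn s : ZMod 7) * zetaSigned (m * μ) (m * r + r') L := by
  have h : ∀ x : ZMod 7, m * (μ * x + r) + r' = m * μ * x + (m * r + r') := fun x => by ring
  simp only [zetaSigned, Signed.move, Multiset.map_map, Function.comp_def, zetaTerm, Term.move,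
    sgn_beq, Int.cast_mul, h, mul_assoc (sgn s : ZMod 7), Multiset.sum_map_mul_left]
  rfl

lemma NoCancel.move {L : Signed} (h : NoCancel L) (s : Bool) {μ : ZMod 7} (hμ : μ ≠ 0)
    (r v : ZMod 7) (e : ℤ) : NoCancel (Signed.move s μ r v e L) := by
  intro x hx y hy hxy
  obtain ⟨x, hx', rfl⟩ := Multiset.mem_map.1 hx
  obtain ⟨y, hy', rfl⟩ := Multiset.mem_map.1 hy
  simp only [h x hx' y hy' (Term.move_injective hμ r v e hxy)]

lemma ratio_ne_one : ∀ a b c : ZMod 7, a ≠ b → b ≠ c → ((c - a) * (b - a) ^ 5).val ≠ 1 := by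
  decide +kernel

lemma searchFrom_eq_true {c₀ : ℕ} (h : c₀ < 7) (h1 : c₀ ≠ 1) : searchFrom c₀ = true := by
  interval_cases c₀
  · exact searchFrom_0
  · exact absurd rfl h1
  · exact searchFrom_2
  · exact searchFrom_3
  · exact searchFrom_4
  · exact searchFrom_5
  · exact searchFrom_6

/-- The minimal degree of `L` is attained at `x`, whose ratio is maximal in this degree. -/
lemma exists_extremal {L : Signed} (h : L ≠ 0) :
    ∃ x ∈ L, ∀ y ∈ L, x.2.d ≤ y.2.d ∧ (y.2.d = x.2.d → y.2.ratio ≤ x.2.ratio) := by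
  classical
  obtain ⟨x₀, hx₀⟩ := Multiset.exists_mem_of_ne_zero h
  obtain ⟨x, hx, hmin⟩ := Finset.exists_min_image L.toFinset (fun x => 7 * x.2.d - x.2.ratio)
    ⟨x₀, Multiset.mem_toFinset.2 hx₀⟩
  have hr : ∀ t : Term, t.ratio < 7 := fun t => by rw [Term.ratio_eq]; exact ZMod.val_lt _
  refine ⟨x, Multiset.mem_toFinset.1 hx, fun y hy => ?_⟩
  have h1 := hmin y (Multiset.mem_toFinset.2 hy)
  have h2 := hr x.2
  have h3 := hr y.2
  omega

/-- Every extremal term can be moved to `((0, 0); 0, 1, c₀)`. -/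
lemma exists_move_eq {t : Term} (h : t.Nondeg) : ∃ μ r v : ZMod 7, μ ≠ 0 ∧
    t.move μ r v t.d = NTerm.toTerm ⟨0, 0, 0, 1, t.ratio⟩ := by
  have hb : t.b - t.a ≠ 0 := sub_ne_zero.2 h.1.symm
  have h6 := pow_six_eq_one _ hb
  refine ⟨(t.b - t.a) ^ 5, -((t.b - t.a) ^ 5 * t.a),
    -(paritySign t.d * ((t.b - t.a) ^ 5 * t.u - (t.b - t.a) ^ 5 * t.a)), pow_ne_zero _ hb, ?_⟩
  ext1
  · simp [Term.move, NTerm.toTerm]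
  · simp only [Term.move, NTerm.toTerm, Nat.cast_zero]
    linear_combination -((t.b - t.a) ^ 5 * t.u - (t.b - t.a) ^ 5 * t.a) * paritySign_mul_self t.d
  · simp [Term.move, NTerm.toTerm]
  · simp only [Term.move, NTerm.toTerm, Nat.cast_one]
    linear_combination h6
  · simp only [Term.move, NTerm.toTerm, Term.ratio_eq, ZMod.natCast_zmod_val]
    ring

/-- The Mochizuki cocycle vanishes on the cycles of length at most `7`. -/
theorem zetaSigned_eq_zero (n : ℕ) (hn : n ≤ 7) : ∀ L : Signed, L.card ≤ n → IsCycle L →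
    (∀ x ∈ L, x.2.Nondeg) → NoCancel L → ∀ m r, zetaSigned m r L = 0 := by
  induction n with
  | zero =>
    intro L hL _ _ _ m r
    rw [Multiset.card_eq_zero.1 (Nat.le_zero.1 hL), zetaSigned_zero]
  | succ n ih =>
    intro L hL hcyc hnd hcan m r
    rcases eq_or_ne L 0 with rfl | h0
    · rfl
    obtain ⟨⟨s, t⟩, hx, hext⟩ := exists_extremal h0
    obtain ⟨μ, ρ, v, hμ, hmove⟩ := exists_move_eq (hnd _ hx)
    obtain ⟨M, hM⟩ := Multiset.exists_cons_of_mem hx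
    have hLM : Signed.move s μ ρ v t.d L = (true, NTerm.toTerm ⟨0, 0, 0, 1, t.ratio⟩) ::ₘ
        Signed.move s μ ρ v t.d M := by
      simp [hM, Signed.move, hmove]
    have hcard : M.card ≤ n := by
      rw [hM, Multiset.card_cons] at hL
      omega
    have hcyc' : IsCycle (Signed.move s μ ρ v t.d L) := fun F => by
      rw [bdSum_move s hμ, hcyc, mul_zero]
    have hcan' := hcan.move s hμ ρ v t.d
    have hnd' : ∀ x ∈ Signed.move s μ ρ v t.d L, x.2.Nondeg := fun x hx => by
      obtain ⟨y, hy, rfl⟩ := Multiset.mem_map.1 hx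
      exact (hnd y hy).move hμ ρ v t.d
    have hadm : ∀ x ∈ Signed.move s μ ρ v t.d L, x.2.Admissible t.ratio := fun x hx => by
      refine ⟨?_, hnd' x hx, ?_⟩
      all_goals
        obtain ⟨y, hy, rfl⟩ := Multiset.mem_map.1 hx
        have := hext y hy
      · simpa [Term.move] using this.1
      · intro hd
        rw [Term.ratio_move hμ]
        exact this.2 (by simpa [Term.move, sub_eq_zero] using hd)
    have hlt : t.ratio < 7 := by rw [Term.ratio_eq]; exact ZMod.val_lt _
    have hne : t.ratio ≠ 1 := by
      rw [Term.ratio_eq]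
      exact ratio_ne_one _ _ _ (hnd _ hx).1 (hnd _ hx).2
    rw [hLM] at hadm hcan' hcyc' hnd'
    obtain ⟨L', hle, hc, hz⟩ := searchFrom_sound hlt (searchFrom_eq_true hlt hne)
      (by rw [Signed.move, Multiset.card_map]; omega) hadm hcan' hcyc'
    have hmem : ∀ x ∈ L', x ∈ (true, NTerm.toTerm ⟨0, 0, 0, 1, t.ratio⟩) ::ₘ
        Signed.move s μ ρ v t.d M := fun x hx =>
      Multiset.mem_cons_of_mem (Multiset.mem_of_le hle hx)
    have hzero := hz (m * μ⁻¹) (r - m * μ⁻¹ * ρ)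
    rw [ih (by omega) L' ((Multiset.card_le_card hle).trans
      (by rwa [Signed.move, Multiset.card_map])) hc (fun x hx => hnd' x (hmem x hx))
      (fun x hx y hy => hcan' x (hmem x hx) y (hmem y hy))] at hzero
    have hcons : decodeList [(true, ⟨0, 0, 0, 1, t.ratio⟩)] + Signed.move s μ ρ v t.d M =
        Signed.move s μ ρ v t.d L := by
      rw [hLM]; rfl
    rw [hcons, zetaSigned_move, inv_mul_cancel_right₀ hμ, add_sub_cancel] at hzero
    cases s <;> simpa [sgn] using hzero

/-! ### Chains -/

section Chains

variable {X S A : Type*} [AddCommGroup A]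

lemma gen_of_chain (s : S) (l : List X) (h : l.IsChain (· ≠ ·)) :
    gen s l = Finsupp.single ⟨(s, l), h⟩ 1 := dif_pos h

@[simp] lemma gen_pair_self (s : S) (x : X) : gen s [x, x] = 0 :=
  dif_neg fun h : [x, x].IsChain (· ≠ ·) => by simp at h

lemma isChain_triple {a b c : X} (hab : a ≠ b) (hbc : b ≠ c) : [a, b, c].IsChain (· ≠ ·) := by
  simp [hab, hbc]

lemma fOn_triple (s : S) (a b c : X) (h : [a, b, c].IsChain (· ≠ ·)) :
    fOn ⟨(s, [a, b, c]), h⟩ = -gen s [b, c] + gen s [a, c] - gen s [a, b] := by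
  change ∑ j : Fin 3, ((-1 : ℤ) ^ ((j : ℕ) + 1)) • gen s ([a, b, c].eraseIdx (j : ℕ)) = _
  simp [Fin.sum_univ_three, sub_eq_add_neg]

lemma gOn_triple (op : X → X → X) (sact : S → X → S) (s : S) (a b c : X)
    (h : [a, b, c].IsChain (· ≠ ·)) : gOn op sact ⟨(s, [a, b, c]), h⟩ =
      gen (sact s a) [b, c] - gen (sact s b) [op a b, c] + gen (sact s c) [op a c, op b c] := by
  change ∑ j : Fin 3, ((-1 : ℤ) ^ (j : ℕ)) • gen (sact s ([a, b, c].get j))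
    (([a, b, c].take (j : ℕ)).map (fun x => op x ([a, b, c].get j)) ++
      [a, b, c].drop ((j : ℕ) + 1)) = _
  simp [Fin.sum_univ_three, sub_eq_add_neg]

lemma bd_eq_linearCombination (op : X → X → X) (sact : S → X → S) (γ : Ch X S) :
    bd op sact γ = Finsupp.linearCombination ℤ (fun t => fOn t + gOn op sact t) γ := by
  simp only [bd, fmap, gmap, Finsupp.linearCombination_apply, Finsupp.sum, smul_add,
    Finset.sum_add_distrib]

lemma evalCh_proj (θ : List X → A) (γ : Ch X S) :
    evalCh θ (proj γ) = Finsupp.linearCombination ℤ (fun t => θ t.1.2) γ := by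
  have h : ∀ δ : Ch X Unit, evalCh θ δ = Finsupp.linearCombination ℤ (fun t => θ t.1.2) δ :=
    fun δ => rfl
  rw [h, proj, map_finsuppSum, Finsupp.linearCombination_apply]
  refine Finsupp.sum_congr fun t _ => ?_
  rw [map_smul, gen_of_chain _ _ t.2, Finsupp.linearCombination_single, one_smul]

lemma bd_add (op : X → X → X) (sact : S → X → S) (γ δ : Ch X S) :
    bd op sact (γ + δ) = bd op sact γ + bd op sact δ := by
  simp only [bd_eq_linearCombination, map_add]

lemma bd_sub (op : X → X → X) (sact : S → X → S) (γ δ : Ch X S) :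
    bd op sact (γ - δ) = bd op sact γ - bd op sact δ := by
  simp only [bd_eq_linearCombination, map_sub]

lemma bd_gen (op : X → X → X) (sact : S → X → S) (s : S) {a b c : X} (hab : a ≠ b) (hbc : b ≠ c) :
    bd op sact (gen s [a, b, c]) = -gen s [b, c] + gen s [a, c] - gen s [a, b] +
      (gen (sact s a) [b, c] - gen (sact s b) [op a b, c] + gen (sact s c) [op a c, op b c]) := by
  rw [gen_of_chain _ _ (isChain_triple hab hbc), bd_eq_linearCombination,
    Finsupp.linearCombination_single, one_smul, fOn_triple, gOn_triple]

lemma evalCh_proj_add (θ : List X → A) (γ δ : Ch X S) :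
    evalCh θ (proj (γ + δ)) = evalCh θ (proj γ) + evalCh θ (proj δ) := by
  simp only [evalCh_proj, map_add]

lemma evalCh_proj_sub (θ : List X → A) (γ δ : Ch X S) :
    evalCh θ (proj (γ - δ)) = evalCh θ (proj γ) - evalCh θ (proj δ) := by
  simp only [evalCh_proj, map_sub]

lemma evalCh_proj_gen (θ : List X → A) (s : S) {a b c : X} (hab : a ≠ b) (hbc : b ≠ c) :
    evalCh θ (proj (gen s [a, b, c])) = θ [a, b, c] := by
  rw [evalCh_proj, gen_of_chain _ _ (isChain_triple hab hbc), Finsupp.linearCombination_single,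
    one_smul]

lemma isMChain_gen (s : S) (l : List X) : IsMChain l.length (gen s l) := by
  intro t ht
  by_cases h : l.IsChain (· ≠ ·)
  · rw [gen_of_chain _ _ h] at ht
    rw [Finset.mem_singleton.1 (Finsupp.support_single_subset ht)]
  · rw [show gen s l = 0 from dif_neg h] at ht
    simp at ht

lemma IsMChain.add {m : ℕ} {γ δ : Ch X S} (hγ : IsMChain m γ) (hδ : IsMChain m δ) :
    IsMChain m (γ + δ) := by
  classical
  intro t ht
  rcases Finset.mem_union.1 (Finsupp.support_add ht) with h | h
  exacts [hγ t h, hδ t h]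

lemma IsMChain.sub {m : ℕ} {γ δ : Ch X S} (hγ : IsMChain m γ) (hδ : IsMChain m δ) :
    IsMChain m (γ - δ) := by
  classical
  intro t ht
  rcases Finset.mem_union.1 (Finsupp.support_sub ht) with h | h
  exacts [hγ t h, hδ t h]

lemma chainLen_neg (γ : Ch X S) : chainLen (-γ) = chainLen γ := by
  simp [chainLen, Finsupp.sum]

lemma chainLen_add_le (γ δ : Ch X S) : chainLen (γ + δ) ≤ chainLen γ + chainLen δ := by
  classical
  have h : ∀ ε : Ch X S, ε.support ⊆ γ.support ∪ δ.support →
      chainLen ε = ∑ t ∈ γ.support ∪ δ.support, (ε t).natAbs := fun ε hε =>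
    Finsupp.sum_of_support_subset _ hε _ (by simp)
  rw [h _ Finsupp.support_add, h _ Finset.subset_union_left, h _ Finset.subset_union_right,
    ← Finset.sum_add_distrib]
  exact Finset.sum_le_sum fun t _ => Int.natAbs_add_le _ _

lemma chainLen_sub_le (γ δ : Ch X S) : chainLen (γ - δ) ≤ chainLen γ + chainLen δ := by
  rw [sub_eq_add_neg, ← chainLen_neg δ]
  exact chainLen_add_le _ _

lemma chainLen_gen_le (s : S) (l : List X) : chainLen (gen s l) ≤ 1 := by
  by_cases h : l.IsChain (· ≠ ·)
  · simp [gen_of_chain _ _ h, chainLen]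
  · simp [show gen s l = 0 from dif_neg h, chainLen]

end Chains

/-! ### A cycle of length `8` -/

lemma exists_short {S : Type*} (A : QSet (ZMod 7) R7op S) (s : S) :
    ∃ γ : Ch (ZMod 7) S, IsMChain 3 γ ∧ bd R7op A.sact γ = 0 ∧
      evalCh zetaL (proj γ) ≠ 0 ∧ chainLen γ ≤ 8 := by
  have hc := A.comm s
  have c1 : A.sact (A.sact s 6) 0 = A.sact (A.sact s 1) 2 := (hc 6 0).trans (hc 0 1)
  have c2 : A.sact (A.sact s 6) 4 = A.sact (A.sact s 1) 6 := (hc 1 6).symm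
  have c3 : A.sact (A.sact s 6) 1 = A.sact (A.sact s 1) 3 := hc 6 1
  have c4 : A.sact (A.sact s 6) 5 = A.sact (A.sact s 1) 0 := ((hc 1 0).trans (hc 0 6)).symm
  refine ⟨gen s [0, 1, 6] + gen s [0, 6, 1] - gen s [1, 6, 0] - gen s [6, 1, 0] -
    gen (A.sact s 1) [2, 6, 3] + gen (A.sact s 6) [1, 4, 0] + gen (A.sact s 1) [6, 3, 0] -
    gen (A.sact s 6) [5, 1, 4], ?_, ?_, ?_, ?_⟩
  · have h : ∀ (s : S) (a b c : ZMod 7), IsMChain 3 (gen s [a, b, c]) := fun s a b c =>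
      isMChain_gen s [a, b, c]
    refine .sub (.add (.add (.sub (.sub (.sub (.add ?_ ?_) ?_) ?_) ?_) ?_) ?_) ?_ <;>
      exact h _ _ _ _
  · have e : ∀ (s : S) (a b c x y z : ZMod 7), a ≠ b → b ≠ c → R7op a b = x → R7op a c = y →
        R7op b c = z → bd R7op A.sact (gen s [a, b, c]) =
          -gen s [b, c] + gen s [a, c] - gen s [a, b] +
          (gen (A.sact s a) [b, c] - gen (A.sact s b) [x, c] + gen (A.sact s c) [y, z]) := by
      rintro s a b c _ _ _ hab hbc rfl rfl rfl
      exact bd_gen _ _ _ hab hbc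
    simp only [bd_add, bd_sub]
    rw [e s 0 1 6 2 5 4 (by decide) (by decide) (by decide) (by decide) (by decide),
      e s 0 6 1 5 2 3 (by decide) (by decide) (by decide) (by decide) (by decide),
      e s 1 6 0 4 6 1 (by decide) (by decide) (by decide) (by decide) (by decide),
      e s 6 1 0 3 1 6 (by decide) (by decide) (by decide) (by decide) (by decide),
      e (A.sact s 1) 2 6 3 3 4 0 (by decide) (by decide) (by decide) (by decide) (by decide),
      e (A.sact s 6) 1 4 0 0 6 3 (by decide) (by decide) (by decide) (by decide) (by decide),
      e (A.sact s 1) 6 3 0 0 1 4 (by decide) (by decide) (by decide) (by decide) (by decide),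
      e (A.sact s 6) 5 1 4 4 3 0 (by decide) (by decide) (by decide) (by decide) (by decide)]
    simp only [c1, c2, c3, c4, gen_pair_self]
    abel
  · have e : ∀ (s : S) (a b c : ZMod 7), a ≠ b → b ≠ c →
        evalCh zetaL (proj (gen s [a, b, c])) = zetaFun a b c := fun s a b c hab hbc =>
      evalCh_proj_gen _ s hab hbc
    simp only [evalCh_proj_add, evalCh_proj_sub]
    rw [e s 0 1 6 (by decide) (by decide), e s 0 6 1 (by decide) (by decide),
      e s 1 6 0 (by decide) (by decide), e s 6 1 0 (by decide) (by decide),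
      e _ 2 6 3 (by decide) (by decide), e _ 1 4 0 (by decide) (by decide),
      e _ 6 3 0 (by decide) (by decide), e _ 5 1 4 (by decide) (by decide)]
    decide +kernel
  · have h := chainLen_gen_le (X := ZMod 7) (S := S)
    refine (chainLen_sub_le _ _).trans (Nat.add_le_add (b := 7) (d := 1) ?_ (h ..))
    refine (chainLen_add_le _ _).trans (Nat.add_le_add (b := 6) (d := 1) ?_ (h ..))
    refine (chainLen_add_le _ _).trans (Nat.add_le_add (b := 5) (d := 1) ?_ (h ..))
    refine (chainLen_sub_le _ _).trans (Nat.add_le_add (b := 4) (d := 1) ?_ (h ..))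
    refine (chainLen_sub_le _ _).trans (Nat.add_le_add (b := 3) (d := 1) ?_ (h ..))
    refine (chainLen_sub_le _ _).trans (Nat.add_le_add (b := 2) (d := 1) ?_ (h ..))
    exact (chainLen_add_le _ _).trans (Nat.add_le_add (h ..) (h ..))

/-- The `R₇`-set `ℤ × R₇`. -/
def zactQSet : QSet (ZMod 7) R7op (ℤ × ZMod 7) where
  sact := zact R7op
  bij a := Function.bijective_iff_has_inverse.2 ⟨fun s => (s.1 - 1, 2 * a - s.2),
    fun s => by simp [zact, R7op], fun s => by simp [zact, R7op]⟩
  comm s a b := by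
    simp only [zact, R7op, Prod.mk.injEq, true_and]
    ring

/-! ### Chains as signed multisets of terms -/

def termOf (t : Gen (ZMod 7) (ℤ × ZMod 7)) : Term :=
  ⟨t.1.1.1, t.1.1.2, t.1.2.getD 0 0, t.1.2.getD 1 0, t.1.2.getD 2 0⟩

lemma exists_triple {S : Type*} {t : Gen (ZMod 7) S} (h : t.1.2.length = 3) :
    ∃ (s : S) (a b c : ZMod 7) (hab : a ≠ b) (hbc : b ≠ c),
      t = ⟨(s, [a, b, c]), isChain_triple hab hbc⟩ := by
  obtain ⟨⟨s, l⟩, hl⟩ := t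
  obtain ⟨a, b, c, rfl⟩ := List.length_eq_three.1 h
  have hl' : [a, b, c].IsChain (· ≠ ·) := hl
  simp only [List.isChain_cons_cons, List.isChain_singleton, and_true] at hl'
  exact ⟨s, a, b, c, hl'.1, hl'.2, rfl⟩

/-- The signed multiset of terms of a chain. -/
noncomputable def toSigned (γ : Ch (ZMod 7) (ℤ × ZMod 7)) : Signed :=
  ∑ t ∈ γ.support, Multiset.replicate (γ t).natAbs (decide (0 < γ t), termOf t)

lemma card_toSigned (γ : Ch (ZMod 7) (ℤ × ZMod 7)) : (toSigned γ).card = chainLen γ := by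
  simp [toSigned, chainLen, Finsupp.sum]

lemma sum_map_toSigned {A : Type*} [AddCommGroup A] (g : Term → A)
    (γ : Ch (ZMod 7) (ℤ × ZMod 7)) : ((toSigned γ).map fun x => sgn x.1 • g x.2).sum =
      Finsupp.linearCombination ℤ (fun t => g (termOf t)) γ := by
  rw [toSigned, ← Multiset.coe_mapAddMonoidHom, map_sum, Multiset.sum_sum,
    Finsupp.linearCombination_apply]
  refine Finset.sum_congr rfl fun t _ => ?_
  rw [Multiset.coe_mapAddMonoidHom, Multiset.map_replicate, Multiset.sum_replicate,
    ← natCast_zsmul, smul_smul]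
  congr 1
  rw [Int.natCast_natAbs]
  by_cases h : 0 < γ t
  · simp [sgn, h, abs_of_pos h]
  · simp [sgn, h, abs_of_nonpos (not_lt.1 h)]

lemma mem_toSigned {γ : Ch (ZMod 7) (ℤ × ZMod 7)} {x : Bool × Term} (hx : x ∈ toSigned γ) :
    ∃ t ∈ γ.support, x = (decide (0 < γ t), termOf t) := by
  obtain ⟨t, ht, hx⟩ := Multiset.mem_sum.1 hx
  exact ⟨t, ht, Multiset.eq_of_mem_replicate hx⟩

lemma nondeg_of_mem_toSigned {γ : Ch (ZMod 7) (ℤ × ZMod 7)} (hγ : IsMChain 3 γ) {x : Bool × Term}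
    (hx : x ∈ toSigned γ) : x.2.Nondeg := by
  obtain ⟨t, ht, rfl⟩ := mem_toSigned hx
  obtain ⟨s, a, b, c, hab, hbc, rfl⟩ := exists_triple (hγ t ht)
  exact ⟨hab, hbc⟩

lemma noCancel_toSigned {γ : Ch (ZMod 7) (ℤ × ZMod 7)} (hγ : IsMChain 3 γ) :
    NoCancel (toSigned γ) := by
  intro x hx y hy hxy
  obtain ⟨t, ht, rfl⟩ := mem_toSigned hx
  obtain ⟨t', ht', rfl⟩ := mem_toSigned hy
  suffices t = t' by rw [this]
  obtain ⟨⟨d, u⟩, a, b, c, hab, hbc, rfl⟩ := exists_triple (hγ t ht)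
  obtain ⟨⟨d', u'⟩, a', b', c', hab', hbc', rfl⟩ := exists_triple (hγ t' ht')
  simp only [termOf, Term.mk.injEq] at hxy
  obtain ⟨h1, h2, h3, h4, h5⟩ := hxy
  obtain rfl : a = a' := h3
  obtain rfl : b = b' := h4
  obtain rfl : c = c' := h5
  subst h1 h2
  rfl

/-- The value of a test function on `2`-chains. -/
noncomputable def faceLin (F : FaceFun) : Ch (ZMod 7) (ℤ × ZMod 7) →ₗ[ℤ] ℤ :=
  Finsupp.linearCombination ℤ fun t => F t.1.1.1 t.1.1.2 (t.1.2.getD 0 0) (t.1.2.getD 1 0)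

lemma faceLin_gen (F : FaceFun) (d : ℤ) (u x y : ZMod 7) :
    faceLin F (gen (d, u) [x, y]) = faceVal F d u x y := by
  by_cases h : x = y
  · simp [h, faceVal]
  · rw [gen_of_chain _ _ (by simpa using h), faceLin, Finsupp.linearCombination_single, one_smul,
      faceVal, if_neg h]
    rfl

lemma isCycle_toSigned {γ : Ch (ZMod 7) (ℤ × ZMod 7)} (hγ : IsMChain 3 γ)
    (hbd : bd R7op (zact R7op) γ = 0) : IsCycle (toSigned γ) := by
  intro F
  have h1 : bdSum F (toSigned γ) = _ := sum_map_toSigned (bdVal F) γ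
  have h2 := congrArg (faceLin F) hbd
  rw [bd_eq_linearCombination, map_zero, Finsupp.linearCombination_apply, map_finsuppSum] at h2
  rw [h1, ← h2, Finsupp.linearCombination_apply]
  refine Finsupp.sum_congr fun t ht => ?_
  obtain ⟨⟨d, u⟩, a, b, c, hab, hbc, rfl⟩ := exists_triple (hγ t ht)
  rw [map_smul, fOn_triple, gOn_triple]
  simp only [map_add, map_sub, map_neg, zact, faceLin_gen, R7op]
  congr 1
  change bdVal F ⟨d, u, a, b, c⟩ = _
  unfold bdVal
  ring

lemma zetaSigned_toSigned {γ : Ch (ZMod 7) (ℤ × ZMod 7)} (hγ : IsMChain 3 γ) :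
    zetaSigned 1 0 (toSigned γ) = evalCh zetaL (proj γ) := by
  have h : zetaTerm 1 0 = fun x => sgn x.1 • zetaFun x.2.a x.2.b x.2.c := by
    funext x
    simp [zetaTerm]
  rw [zetaSigned, h, sum_map_toSigned fun t => zetaFun t.a t.b t.c, evalCh_proj,
    Finsupp.linearCombination_apply, Finsupp.linearCombination_apply]
  refine Finsupp.sum_congr fun t ht => ?_
  obtain ⟨s, a, b, c, hab, hbc, rfl⟩ := exists_triple (hγ t ht)
  rfl

theorem eight_le_chainLen {γ : Ch (ZMod 7) (ℤ × ZMod 7)} (hγ : IsMChain 3 γ)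
    (hbd : bd R7op (zact R7op) γ = 0) (hζ : evalCh zetaL (proj γ) ≠ 0) : 8 ≤ chainLen γ := by
  by_contra! hlt
  rw [← zetaSigned_toSigned hγ] at hζ
  exact hζ (zetaSigned_eq_zero 7 le_rfl _ (by rw [card_toSigned]; omega) (isCycle_toSigned hγ hbd)
    (fun _ => nondeg_of_mem_toSigned hγ) (noCancel_toSigned hγ) 1 0)

end Soundness
/-- The length of the Mochizuki 3-cocycle `ζ` of the 7-dihedral quandle `R₇`
is equal to `8`. -/
theorem length_of_mochizuki_cocycle_R7_eq_eight :
    (∀ (S : Type*) (A : QSet (ZMod 7) R7op S),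
        (∃ γ : Ch (ZMod 7) S, IsMChain 3 γ ∧ bd R7op A.sact γ = 0 ∧
            evalCh zetaL (proj γ) ≠ 0) →
        ∃ γ : Ch (ZMod 7) S, IsMChain 3 γ ∧ bd R7op A.sact γ = 0 ∧
            evalCh zetaL (proj γ) ≠ 0 ∧ chainLen γ ≤ 8) ∧
    (∃ γ : Ch (ZMod 7) (ℤ × ZMod 7), IsMChain 3 γ ∧ bd R7op (zact R7op) γ = 0 ∧
        evalCh zetaL (proj γ) ≠ 0 ∧ chainLen γ = 8) ∧
    (∀ γ : Ch (ZMod 7) (ℤ × ZMod 7), IsMChain 3 γ → bd R7op (zact R7op) γ = 0 →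
        evalCh zetaL (proj γ) ≠ 0 → 8 ≤ chainLen γ) := by
  refine ⟨fun S A ⟨γ, _, _, hζ⟩ => ?_, ?_, fun γ => eight_le_chainLen⟩
  · obtain ⟨t, -⟩ : γ.support.Nonempty := by
      rw [Finsupp.support_nonempty_iff]
      rintro rfl
      exact hζ (by rw [evalCh_proj, map_zero])
    exact exists_short A t.1.1
  · obtain ⟨γ, h1, h2, h3, h4⟩ := exists_short zactQSet (0, 0)
    exact ⟨γ, h1, h2, h3, h4.antisymm (eight_le_chainLen h1 h2 h3)⟩

end QHom
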